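/- For every ν ∈ ℝ and every smooth pair (v,w) : ℝ³ → ℝ³ × ℝ, the identity 𝔏ν(P(v,w)) = R(Δv, Δw) holds pointwise on ℝ³, where Δ acts componentwise on v; that is, the 3D Lamé–Navier operator 𝔏ν is a post-catalysis of the componentwise Laplace operator Δ^{⊗4} by the differential operators (P,R). -/

import Mathlib

noncomputable section

/-- The space `ℝ³` as a Euclidean space. -/
abbrev E3 : Type := EuclideanSpace ℝ (Fin 3)

/-- `i`-th partial derivative of a scalar function on `ℝ³`. -/
def pd3 (i : Fin 3) (f : E3 → ℝ) (x : E3) : ℝ :=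
  fderiv ℝ f x (EuclideanSpace.single i 1)

/-- Laplacian of a scalar function on `ℝ³`. -/
def lap3 (f : E3 → ℝ) (x : E3) : ℝ :=
  ∑ i, pd3 i (pd3 i f) x

/-- Divergence of a vector field on `ℝ³`. -/
def div3 (v : E3 → E3) (x : E3) : ℝ :=
  ∑ i, pd3 i (fun y => v y i) x

/-- Gradient of a scalar function on `ℝ³`. -/
def grad3 (p : E3 → ℝ) (x : E3) : E3 :=
  ∑ i, pd3 i p x • EuclideanSpace.single i 1

/-- Componentwise Laplacian of a vector field on `ℝ³`. -/
def vecLap3 (u : E3 → E3) (x : E3) : E3 :=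
  ∑ i, lap3 (fun y => u y i) x • EuclideanSpace.single i 1

/-- Cross product on `ℝ³`. -/
def cross3 (a b : E3) : E3 :=
  (a 1 * b 2 - a 2 * b 1) • EuclideanSpace.single 0 1 +
  (a 2 * b 0 - a 0 * b 2) • EuclideanSpace.single 1 1 +
  (a 0 * b 1 - a 1 * b 0) • EuclideanSpace.single 2 1

/-- Curl of a vector field on `ℝ³`. -/
def curl3 (v : E3 → E3) (x : E3) : E3 :=
  (pd3 1 (fun y => v y 2) x - pd3 2 (fun y => v y 1) x) • EuclideanSpace.single 0 1 +
  (pd3 2 (fun y => v y 0) x - pd3 0 (fun y => v y 2) x) • EuclideanSpace.single 1 1 +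
  (pd3 0 (fun y => v y 1) x - pd3 1 (fun y => v y 0) x) • EuclideanSpace.single 2 1

/-- The 3D Lamé–Navier operator `𝔏ν (u,p) = (Δu − ∇p, div u − ν p)`. -/
def lame3 (ν : ℝ) (u : E3 → E3) (p : E3 → ℝ) (x : E3) : E3 × ℝ :=
  (vecLap3 u x - grad3 p x, div3 u x - ν * p x)

/-- First (vector) component of the operator `P`:
`(3/2 − 2ν) v − ½ x div v − ½ x ∧ (curl v − ∇w)`. -/
def Pfst3 (ν : ℝ) (v : E3 → E3) (w : E3 → ℝ) (x : E3) : E3 :=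
  (3 / 2 - 2 * ν) • v x - (div3 v x / 2) • x
    - (1 / 2 : ℝ) • cross3 x (curl3 v x - grad3 w x)

/-- Second (scalar) component of the operator `P`: `−2 div v`. -/
def Psnd3 (v : E3 → E3) (x : E3) : ℝ :=
  -2 * div3 v x

/-- The operator
`R(v,w) = ((5/2 − 2ν) v − ½ x div v − ½ x ∧ (curl v − ∇w), −½ x·v)`. -/
def Rop3 (ν : ℝ) (v : E3 → E3) (w : E3 → ℝ) (x : E3) : E3 × ℝ :=
  ((5 / 2 - 2 * ν) • v x - (div3 v x / 2) • x
      - (1 / 2 : ℝ) • cross3 x (curl3 v x - grad3 w x),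
    -(∑ i, x i * v x i) / 2)

theorem pd3_smooth (i : Fin 3) {f : E3 → ℝ} (hf : ContDiff ℝ (⊤ : ℕ∞) f) :
    ContDiff ℝ (⊤ : ℕ∞) (pd3 i f) := by
  unfold pd3
  exact (hf.fderiv_right (m := ((⊤ : ℕ∞) : WithTop ℕ∞)) (by norm_cast)).clm_apply contDiff_const

theorem pd3_diff {f : E3 → ℝ} (hf : ContDiff ℝ (⊤ : ℕ∞) f) : Differentiable ℝ f :=
  hf.differentiable (by simp)

theorem pd3_add (i : Fin 3) {f g : E3 → ℝ} (hf : ContDiff ℝ (⊤ : ℕ∞) f)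
    (hg : ContDiff ℝ (⊤ : ℕ∞) g) :
    pd3 i (fun y => f y + g y) = fun y => pd3 i f y + pd3 i g y := by
  funext x
  unfold pd3
  rw [fderiv_fun_add (pd3_diff hf x) (pd3_diff hg x)]
  rfl

theorem pd3_sub (i : Fin 3) {f g : E3 → ℝ} (hf : ContDiff ℝ (⊤ : ℕ∞) f)
    (hg : ContDiff ℝ (⊤ : ℕ∞) g) :
    pd3 i (fun y => f y - g y) = fun y => pd3 i f y - pd3 i g y := by
  funext x
  unfold pd3
  rw [fderiv_fun_sub (pd3_diff hf x) (pd3_diff hg x)]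
  rfl

theorem pd3_cmul (i : Fin 3) (c : ℝ) {f : E3 → ℝ} (hf : ContDiff ℝ (⊤ : ℕ∞) f) :
    pd3 i (fun y => c * f y) = fun y => c * pd3 i f y := by
  funext x
  unfold pd3
  rw [fderiv_const_mul (pd3_diff hf x)]
  rfl

theorem coord3_smooth (j : Fin 3) : ContDiff ℝ (⊤ : ℕ∞) (fun y : E3 => y j) := by
  fun_prop

theorem pd3_coord (i j : Fin 3) (x : E3) :
    pd3 i (fun y => y j) x = if j = i then 1 else 0 := by
  unfold pd3
  have : (fun y : E3 => y j) = (EuclideanSpace.proj j : E3 →L[ℝ] ℝ) := rfl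
  rw [this, ContinuousLinearMap.fderiv]
  simp

theorem pd3_xmul (i j : Fin 3) {f : E3 → ℝ} (hf : ContDiff ℝ (⊤ : ℕ∞) f) :
    pd3 i (fun y => y j * f y) = fun y => (if j = i then 1 else 0) * f y + y j * pd3 i f y := by
  funext x
  rw [← pd3_coord i j x]
  unfold pd3
  rw [fderiv_fun_mul (pd3_diff (coord3_smooth j) x) (pd3_diff hf x)]
  simp
  ring

theorem pd3_comm (i j : Fin 3) {f : E3 → ℝ} (hf : ContDiff ℝ (⊤ : ℕ∞) f) :
    pd3 i (pd3 j f) = pd3 j (pd3 i f) := by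
  funext x
  have hd : Differentiable ℝ (fderiv ℝ f) :=
    (hf.fderiv_right (m := ((⊤ : ℕ∞) : WithTop ℕ∞)) (by norm_cast)).differentiable (by simp)
  have key : ∀ a b : E3, fderiv ℝ (fun y => fderiv ℝ f y a) x b
      = fderiv ℝ (fderiv ℝ f) x b a := by
    intro a b
    rw [fderiv_clm_apply (hd x) (differentiableAt_const a)]
    simp
  have hs : IsSymmSndFDerivAt ℝ f x := hf.contDiffAt.isSymmSndFDerivAt (by
    simp only [minSmoothness_of_isRCLikeNormedField]
    exact WithTop.coe_le_coe.2 (le_top : (2 : ℕ∞) ≤ ⊤))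
  change fderiv ℝ (fun y => fderiv ℝ f y _) x _ = fderiv ℝ (fun y => fderiv ℝ f y _) x _
  rw [key, key]
  exact hs _ _

theorem smooth3_add {f g : E3 → ℝ} (hf : ContDiff ℝ (⊤ : ℕ∞) f)
    (hg : ContDiff ℝ (⊤ : ℕ∞) g) : ContDiff ℝ (⊤ : ℕ∞) (fun y => f y + g y) := hf.add hg

theorem smooth3_sub {f g : E3 → ℝ} (hf : ContDiff ℝ (⊤ : ℕ∞) f)
    (hg : ContDiff ℝ (⊤ : ℕ∞) g) : ContDiff ℝ (⊤ : ℕ∞) (fun y => f y - g y) := hf.sub hg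

theorem smooth3_mul {f g : E3 → ℝ} (hf : ContDiff ℝ (⊤ : ℕ∞) f)
    (hg : ContDiff ℝ (⊤ : ℕ∞) g) : ContDiff ℝ (⊤ : ℕ∞) (fun y => f y * g y) := hf.mul hg

theorem smooth3_cmul (c : ℝ) {f : E3 → ℝ} (hf : ContDiff ℝ (⊤ : ℕ∞) f) :
    ContDiff ℝ (⊤ : ℕ∞) (fun y => c * f y) := contDiff_const.mul hf

theorem vecLap3_apply (u : E3 → E3) (x : E3) (i : Fin 3) :
    vecLap3 u x i = lap3 (fun y => u y i) x := by
  fin_cases i <;> simp [vecLap3, Fin.sum_univ_three]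

theorem grad3_apply (p : E3 → ℝ) (x : E3) (i : Fin 3) : grad3 p x i = pd3 i p x := by
  fin_cases i <;> simp [grad3, Fin.sum_univ_three]

theorem cross3_0 (a b : E3) : cross3 a b 0 = a 1 * b 2 - a 2 * b 1 := by simp [cross3]
theorem cross3_1 (a b : E3) : cross3 a b 1 = a 2 * b 0 - a 0 * b 2 := by simp [cross3]
theorem cross3_2 (a b : E3) : cross3 a b 2 = a 0 * b 1 - a 1 * b 0 := by simp [cross3]

theorem curl3_0 (v : E3 → E3) (x : E3) :
    curl3 v x 0 = pd3 1 (fun y => v y 2) x - pd3 2 (fun y => v y 1) x := by simp [curl3]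
theorem curl3_1 (v : E3 → E3) (x : E3) :
    curl3 v x 1 = pd3 2 (fun y => v y 0) x - pd3 0 (fun y => v y 2) x := by simp [curl3]
theorem curl3_2 (v : E3 → E3) (x : E3) :
    curl3 v x 2 = pd3 0 (fun y => v y 1) x - pd3 1 (fun y => v y 0) x := by simp [curl3]

/-- The 3D Lamé–Navier operator `𝔏ν` is a post-catalysis of the componentwise Laplace
operator `Δ^{⊗4}` by the differential operators `(P,R)`: for every `ν ∈ ℝ` and every smooth
pair `(v,w) : ℝ³ → ℝ³ × ℝ`, `𝔏ν(P(v,w)) = R(Δv, Δw)` pointwise. -/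
theorem lame3_post_catalysis (ν : ℝ) (v : E3 → E3) (w : E3 → ℝ)
    (hv : ContDiff ℝ (⊤ : ℕ∞) v) (hw : ContDiff ℝ (⊤ : ℕ∞) w) (x : E3) :
    lame3 ν (Pfst3 ν v w) (Psnd3 v) x
      = Rop3 ν (fun y => vecLap3 v y) (fun y => lap3 w y) x := by
  have hc : ∀ i, ∃ f : E3 → ℝ, ContDiff ℝ (⊤ : ℕ∞) f ∧ ∀ y, v y i = f y := fun i =>
    ⟨fun y => v y i, by fun_prop, fun _ => rfl⟩
  obtain ⟨a, ha, hav⟩ := hc 0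
  obtain ⟨b, hb, hbv⟩ := hc 1
  obtain ⟨c, hc, hcv⟩ := hc 2
  have e2 : ∀ (u : E3 → E3) (y : E3) (s : ℝ), div3 u y / 2 * s = (1 / 2) * (s * div3 u y) :=
    fun u y s => by ring
  have c10 : ∀ {f : E3 → ℝ}, ContDiff ℝ (⊤ : ℕ∞) f → pd3 1 (pd3 0 f) = pd3 0 (pd3 1 f) :=
    fun h => pd3_comm _ _ h
  have c20 : ∀ {f : E3 → ℝ}, ContDiff ℝ (⊤ : ℕ∞) f → pd3 2 (pd3 0 f) = pd3 0 (pd3 2 f) :=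
    fun h => pd3_comm _ _ h
  have c21 : ∀ {f : E3 → ℝ}, ContDiff ℝ (⊤ : ℕ∞) f → pd3 2 (pd3 1 f) = pd3 1 (pd3 2 f) :=
    fun h => pd3_comm _ _ h
  have l3 : ∀ f, lap3 f = fun y => pd3 0 (pd3 0 f) y + pd3 1 (pd3 1 f) y + pd3 2 (pd3 2 f) y :=
    fun f => by funext y; simp [lap3, Fin.sum_univ_three]
  have d3 : ∀ u, div3 u = fun y => pd3 0 (fun y => u y 0) y + pd3 1 (fun y => u y 1) y
      + pd3 2 (fun y => u y 2) y :=
    fun f => by funext y; simp [div3, Fin.sum_univ_three]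
  have ps : Psnd3 v = fun y => (-2) * div3 v y := rfl
  refine Prod.ext ?_ ?_
  · ext i
    simp only [lame3, Rop3, ps, PiLp.sub_apply, PiLp.smul_apply, smul_eq_mul, vecLap3_apply,
      grad3_apply]
    fin_cases i <;>
    · simp only [Fin.zero_eta, Fin.mk_one, Fin.reduceFinMk, Pfst3, PiLp.sub_apply,
        PiLp.smul_apply, smul_eq_mul, vecLap3_apply,
        grad3_apply, cross3_0, cross3_1, cross3_2, curl3_0, curl3_1, curl3_2, e2]
      simp only [vecLap3_apply, d3, l3, hav, hbv, hcv]
      simp (disch := repeat (first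
        | (assumption) | (apply pd3_smooth) | (apply smooth3_add)
        | (apply smooth3_sub) | (apply smooth3_cmul) | (apply smooth3_mul) | (apply coord3_smooth))) only
        [pd3_add, pd3_sub, pd3_cmul, pd3_xmul, c10, c20, c21]
      simp
      ring
  · simp only [lame3, Rop3, ps, Fin.sum_univ_three, d3 (Pfst3 ν v w), Pfst3, PiLp.sub_apply,
        PiLp.smul_apply, smul_eq_mul, vecLap3_apply,
        grad3_apply, cross3_0, cross3_1, cross3_2, curl3_0, curl3_1, curl3_2, e2]
    simp only [vecLap3_apply, d3, l3, hav, hbv, hcv]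
    simp (disch := repeat (first
        | (assumption) | (apply pd3_smooth) | (apply smooth3_add)
        | (apply smooth3_sub) | (apply smooth3_cmul) | (apply smooth3_mul) | (apply coord3_smooth))) only
        [pd3_add, pd3_sub, pd3_cmul, pd3_xmul, c10, c20, c21]
    simp
    ring


end
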